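/- Let T > 0 and β > 1/3. Let (v, θ) be a weak solution of the inviscid Boussinesq system on [0,T] with smooth initial data (v_in, θ_in) such that v, θ ∈ C([0,T]; C^β(T^3)). Then the kinetic energy balance holds: for every t ∈ [0,T], ∫_{T^3} |v(x,t)|² dx = ∫_{T^3} |v_in(x)|² dx + 2 ∫_0^t ∫_{T^3} θ(x,s) v_3(x,s) dx ds, where v_3 denotes the third component of v. -/

import Mathlib

open MeasureTheory Set Real Filter
open scoped ENNReal NNReal BigOperators

noncomputable section

abbrev V3 := Fin 3 → ℝ

/-- Fundamental domain of the torus `T³ = ℝ³/ℤ³`. -/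
def cube3 : Set V3 := Set.univ.pi fun _ => Set.Ico (0:ℝ) 1

/-- The measure on the torus, realized as Lebesgue measure on the fundamental domain. -/
def muT : Measure V3 := volume.restrict cube3

/-- `ℤ³`-periodicity of a function on `ℝ³`. -/
def Per {α : Type*} (f : V3 → α) : Prop :=
  ∀ (x : V3) (k : Fin 3 → ℤ), f (x + (fun i => (k i : ℝ))) = f x

/-- The partial derivative `∂ᵢ g` at `x`. -/
def pd (g : V3 → ℝ) (i : Fin 3) (x : V3) : ℝ := fderiv ℝ g x (Pi.single i 1)

/-- Divergence of a vector field. -/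
def divg (u : V3 → V3) (x : V3) : ℝ := ∑ i, pd (fun y => u y i) i x

/-- Euclidean norm on `ℝ³`. -/
def nE (x : V3) : ℝ := Real.sqrt (∑ i, x i ^ 2)

/-- Divergence-free smooth periodic test vector fields supported in `[0,T)` in time. -/
def TestV (T : ℝ) (φ : ℝ → V3 → V3) : Prop :=
  ContDiff ℝ (⊤ : ℕ∞) (fun q : ℝ × V3 => φ q.1 q.2) ∧ (∀ t, Per (φ t)) ∧
  (∃ T' : ℝ, T' < T ∧ ∀ t x, T' ≤ t → φ t x = 0) ∧ (∀ t x, divg (φ t) x = 0)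

/-- Smooth periodic scalar test functions supported in `[0,T)` in time. -/
def TestS (T : ℝ) (ψ : ℝ → V3 → ℝ) : Prop :=
  ContDiff ℝ (⊤ : ℕ∞) (fun q : ℝ × V3 => ψ q.1 q.2) ∧ (∀ t, Per (ψ t)) ∧
  (∃ T' : ℝ, T' < T ∧ ∀ t x, T' ≤ t → ψ t x = 0)

/-- Weak solution of the inviscid Boussinesq system on `[0,T]` with initial data
`(vin, θin)`: a continuous pair, divergence-free for a.e. time, satisfying the weak
formulations of the momentum and temperature equations. -/
structure IsWeakBoussinesq (T : ℝ) (vin : V3 → V3) (θin : V3 → ℝ)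
    (v : ℝ → V3 → V3) (θ : ℝ → V3 → ℝ) : Prop where
  contv : ContinuousOn (fun q : ℝ × V3 => v q.1 q.2) (Icc 0 T ×ˢ (univ : Set V3))
  contθ : ContinuousOn (fun q : ℝ × V3 => θ q.1 q.2) (Icc 0 T ×ˢ (univ : Set V3))
  perv : ∀ t, Per (v t)
  perθ : ∀ t, Per (θ t)
  divfree : ∀ᵐ t ∂(volume.restrict (Icc (0:ℝ) T)),
      ∀ ψ : V3 → ℝ, ContDiff ℝ (⊤ : ℕ∞) ψ → Per ψ →
        (∫ x in cube3, ∑ i, v t x i * pd ψ i x) = 0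
  momentum : ∀ φ : ℝ → V3 → V3, TestV T φ →
      (-(∫ x in cube3, ∑ i, vin x i * φ 0 x i))
          - (∫ s in Icc (0:ℝ) T, ∫ x in cube3, ∑ i, deriv (fun r => φ r x i) s * v s x i)
        = ∫ s in Icc (0:ℝ) T, ∫ x in cube3,
            ((∑ i, ∑ j, pd (fun y => φ s y i) j x * v s x i * v s x j) + θ s x * φ s x 2)
  transport : ∀ ψ : ℝ → V3 → ℝ, TestS T ψ →
      (-(∫ x in cube3, θin x * ψ 0 x))
          - (∫ s in Icc (0:ℝ) T, ∫ x in cube3, deriv (fun r => ψ r x) s * θ s x)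
        = ∫ s in Icc (0:ℝ) T, ∫ x in cube3, (∑ i, v s x i * pd (ψ s) i x) * θ s x

/-- Smooth, periodic, (distributionally) divergence-free initial data. -/
def SmoothData (vin : V3 → V3) (θin : V3 → ℝ) : Prop :=
  ContDiff ℝ (⊤ : ℕ∞) vin ∧ ContDiff ℝ (⊤ : ℕ∞) θin ∧ Per vin ∧ Per θin ∧
  ∀ ψ : V3 → ℝ, ContDiff ℝ (⊤ : ℕ∞) ψ → Per ψ →
    (∫ x in cube3, ∑ i, vin x i * pd ψ i x) = 0

theorem cube3_ae_eq_Icc : cube3 =ᵐ[volume] Icc (0 : V3) 1 :=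
  Measure.univ_pi_Ico_ae_eq_Icc (f := fun _ : Fin 3 => (0 : ℝ)) (g := fun _ => 1)

theorem setIntegral_cube3_eq (f : V3 → ℝ) :
    ∫ x in cube3, f x = ∫ x in Icc (0 : V3) 1, f x :=
  setIntegral_congr_set cube3_ae_eq_Icc

theorem volume_real_cube3 : volume.real cube3 = 1 := by
  simp [cube3, Measure.real, volume_pi_pi]

theorem volume_cube3_lt_top : volume cube3 < ⊤ := by
  simp [cube3, volume_pi_pi]

theorem integrableOn_cube3 {f : V3 → ℝ} (hf : Continuous f) : IntegrableOn f cube3 :=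
  (hf.continuousOn.integrableOn_compact isCompact_Icc).congr_set_ae cube3_ae_eq_Icc

theorem integral_cube3_sum {f : Fin 3 → V3 → ℝ} (hf : ∀ i, Continuous (f i)) :
    ∫ x in cube3, ∑ i, f i x = ∑ i, ∫ x in cube3, f i x :=
  integral_finsetSum _ fun i _ => integrableOn_cube3 (hf i)

theorem continuous_integral_cube3 {P : Type*} [TopologicalSpace P] [FirstCountableTopology P]
    [LocallyCompactSpace P] {G : P → V3 → ℝ} (hG : Continuous (Function.uncurry G)) :
    Continuous fun p => ∫ x in cube3, G p x := by
  simp_rw [setIntegral_cube3_eq]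
  exact continuous_parametric_integral_of_continuous hG isCompact_Icc

/-- A continuous function vanishing almost everywhere on the fundamental domain and periodic
vanishes identically. -/
theorem Per.eq_zero_of_integral_sq {f : V3 → ℝ} (hf : Continuous f) (hp : Per f)
    (h : ∫ x in cube3, f x ^ 2 = 0) (x : V3) : f x = 0 := by
  rw [setIntegral_cube3_eq, setIntegral_eq_zero_iff_of_nonneg_ae
    (ae_of_all _ fun x => sq_nonneg (f x))
    ((hf.pow 2).continuousOn.integrableOn_compact isCompact_Icc)] at h
  have hcl : Icc (0 : V3) 1 ⊆ closure (interior (Icc (0 : V3) 1)) := by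
    rw [← pi_univ_Icc, interior_pi_set finite_univ, closure_pi_set]
    simp
  have hz := Measure.eqOn_of_ae_eq (μ := volume) (f := fun x => f x ^ 2) (g := 0) h
    (hf.pow 2).continuousOn continuousOn_const hcl
  have hmem : x + (fun i => ((-⌊x i⌋ : ℤ) : ℝ)) ∈ Icc (0 : V3) 1 := by
    constructor
    · intro i
      have := Int.floor_le (x i)
      simp only [Pi.add_apply, Pi.zero_apply]; push_cast; linarith
    · intro i
      have := Int.lt_floor_add_one (x i)
      simp only [Pi.add_apply, Pi.one_apply]; push_cast; linarith
  have := hz hmem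
  simp only [hp x (fun i => -⌊x i⌋), Pi.zero_apply] at this
  exact pow_eq_zero_iff two_ne_zero |>.1 this

theorem integral_cube3_add {f : V3 → ℝ} (hf : Per f) (a : V3) :
    ∫ x in cube3, f (x + a) = ∫ x in cube3, f x := by
  have hF := ZSpan.isAddFundamentalDomain' (Pi.basisFun ℝ (Fin 3)) (volume : Measure V3)
  rw [ZSpan.fundamentalDomain_pi_basisFun] at hF
  have : Countable (Submodule.span ℤ (range (Pi.basisFun ℝ (Fin 3)))).toAddSubgroup :=
    inferInstanceAs (Countable (Submodule.span ℤ (range (Pi.basisFun ℝ (Fin 3)))))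
  have hinv : ∀ (g : (Submodule.span ℤ (range (Pi.basisFun ℝ (Fin 3)))).toAddSubgroup) (x : V3),
      f (g +ᵥ x) = f x := by
    rintro ⟨g, hg⟩ x
    obtain ⟨c, hc⟩ := (Submodule.mem_span_range_iff_exists_fun ℤ).1 hg
    have : g = fun i => (c i : ℝ) := by
      rw [← hc]; ext i; simp [Finset.sum_apply, Pi.single_apply]
    have h2 := hf x c
    rw [← this, add_comm] at h2
    exact h2
  have h := hF.setIntegral_eq (hF.vadd_of_comm a) hinv
  rw [← image_vadd, (measurePreserving_vadd a (volume : Measure V3)).setIntegral_image_emb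
      (measurableEmbedding_const_vadd a)] at h
  simp only [vadd_eq_add, add_comm a] at h
  exact h.symm

/-- Convolution of `f` with the kernel `k`. -/
def mol (k f : V3 → ℝ) (x : V3) : ℝ := ∫ y, k y * f (x - y)

theorem integrable_mul_of_hasCompactSupport {k f : V3 → ℝ} (hk : Continuous k)
    (hs : HasCompactSupport k) (hf : Continuous f) : Integrable fun y => k y * f y :=
  (hk.mul hf).integrable_of_hasCompactSupport hs.mul_right

theorem continuous_integral_mul {P : Type*} [TopologicalSpace P] [FirstCountableTopology P]
    [LocallyCompactSpace P] {k : V3 → ℝ} (hk : Continuous k) (hs : HasCompactSupport k)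
    {G : P → V3 → ℝ} (hG : Continuous (Function.uncurry G)) :
    Continuous fun p => ∫ y, k y * G p y := by
  have h : ∀ p, ∫ y, k y * G p y = ∫ y in tsupport k, k y * G p y := fun p =>
    (setIntegral_eq_integral_of_forall_compl_eq_zero fun y hy => by
      rw [image_eq_zero_of_notMem_tsupport hy, zero_mul]).symm
  simp_rw [h]
  exact continuous_parametric_integral_of_continuous
    (f := fun p y => k y * G p y) ((hk.comp continuous_snd).mul hG) hs

theorem continuous_mol {P : Type*} [TopologicalSpace P] [FirstCountableTopology P]
    [LocallyCompactSpace P] {k : V3 → ℝ} (hk : Continuous k) (hs : HasCompactSupport k)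
    {g : P → V3 → ℝ} (hg : Continuous (Function.uncurry g)) :
    Continuous fun q : P × V3 => mol k (g q.1) q.2 := by
  refine continuous_integral_mul (P := P × V3) hk hs (G := fun q y => g q.1 (q.2 - y)) ?_
  exact hg.comp (f := fun z : (P × V3) × V3 => (z.1.1, z.1.2 - z.2)) (by fun_prop)

theorem continuous_mol_const {k : V3 → ℝ} (hk : Continuous k) (hs : HasCompactSupport k)
    {f : V3 → ℝ} (hf : Continuous f) : Continuous (mol k f) :=
  continuous_integral_mul hk hs (G := fun x y => f (x - y))
    (hf.comp (f := fun z : V3 × V3 => z.1 - z.2) (by fun_prop))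

theorem Per.mol {k f : V3 → ℝ} (hf : Per f) : Per (mol k f) := fun x m => by
  simp only [_root_.mol, add_sub_right_comm, hf _ m]

theorem contDiff_mol {k f : V3 → ℝ} (hk : ContDiff ℝ (⊤ : ℕ∞) k) (hs : HasCompactSupport k)
    (hf : Continuous f) : ContDiff ℝ (⊤ : ℕ∞) (mol k f) :=
  hs.contDiff_convolution_left (ContinuousLinearMap.mul ℝ ℝ) hk hf.locallyIntegrable

theorem pd_mol {k f : V3 → ℝ} (hk : ContDiff ℝ (⊤ : ℕ∞) k) (hs : HasCompactSupport k)
    (hf : Continuous f) (i : Fin 3) : pd (mol k f) i = mol (pd k i) f := by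
  ext x
  have hk1 : ContDiff ℝ 1 k := hk.of_le (by exact_mod_cast le_top)
  have h := hs.hasFDerivAt_convolution_left (ContinuousLinearMap.mul ℝ ℝ) hk1
    (hf.locallyIntegrable (μ := volume)) x
  have he : Integrable (fun t => (ContinuousLinearMap.precompL V3 (ContinuousLinearMap.mul ℝ ℝ))
      (fderiv ℝ k t) (f (x - t))) volume :=
    (hs.fderiv ℝ).convolutionExists_left _ (hk1.continuous_fderiv one_ne_zero)
      hf.locallyIntegrable x
  have h' : fderiv ℝ (mol k f) x = _ := h.fderiv
  rw [pd, h', convolution, ContinuousLinearMap.integral_apply he]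
  rfl

theorem continuous_pd {k : V3 → ℝ} (hk : ContDiff ℝ (⊤ : ℕ∞) k) (i : Fin 3) :
    Continuous (pd k i) :=
  (hk.continuous_fderiv (by simp)).clm_apply continuous_const

theorem hasCompactSupport_pd {k : V3 → ℝ} (hs : HasCompactSupport k) (i : Fin 3) :
    HasCompactSupport (pd k i) :=
  hs.fderiv_apply ℝ _

theorem pd_neg_of_even {k : V3 → ℝ} (he : ∀ y, k (-y) = k y) (i : Fin 3) (y : V3) :
    pd k i (-y) = - pd k i y := by
  have h : (fun y => k (-y)) = k := funext he
  have h2 := fderiv_comp_smul (𝕜 := ℝ) (f := k) (x := y) (c := (-1 : ℝ))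
  simp only [neg_smul, one_smul] at h2
  rw [h] at h2
  simp [pd, h2]

theorem integral_mul_mol {k f g : V3 → ℝ} (hk : Continuous k) (hs : HasCompactSupport k)
    (hf : Continuous f) (hg : Continuous g) :
    ∫ x in cube3, f x * mol k g x = ∫ y, k y * ∫ x in cube3, f x * g (x - y) := by
  have hi : Integrable (Function.uncurry fun x y => f x * (k y * g (x - y)))
      ((volume.restrict (Icc (0 : V3) 1)).prod volume) := by
    have hc : Continuous (Function.uncurry fun x y : V3 => f x * (k y * g (x - y))) := by
      simp only [Function.uncurry_def]; fun_prop
    have := (hc.continuousOn (s := Icc (0 : V3) 1 ×ˢ tsupport k)).integrableOn_compact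
      (μ := volume.prod volume) (isCompact_Icc.prod hs)
    rw [IntegrableOn, ← Measure.prod_restrict] at this
    rw [← Measure.restrict_univ (μ := (volume : Measure V3)), Measure.restrict_restrict
      measurableSet_Icc, inter_univ, Measure.prod_restrict]
    rw [Measure.prod_restrict] at this
    refine IntegrableOn.of_forall_sdiff_eq_zero this
      (measurableSet_Icc.prod MeasurableSet.univ) ?_
    rintro ⟨x, y⟩ ⟨⟨h1, -⟩, h2⟩
    have : y ∉ tsupport k := fun h => h2 ⟨h1, h⟩
    simp [Function.uncurry, image_eq_zero_of_notMem_tsupport this]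
  simp_rw [setIntegral_cube3_eq, mol, ← integral_const_mul]
  rw [integral_integral_swap hi]
  simp_rw [mul_left_comm]

/-- The adjoint of convolution with a kernel of parity `c`. -/
theorem integral_mul_mol_comm {k f g : V3 → ℝ} (hk : Continuous k) (hs : HasCompactSupport k)
    (hf : Continuous f) (hg : Continuous g) (pf : Per f) (pg : Per g) {c : ℝ}
    (hpar : ∀ y, k (-y) = c * k y) :
    ∫ x in cube3, f x * mol k g x = c * ∫ x in cube3, g x * mol k f x := by
  rw [integral_mul_mol hk hs hf hg, integral_mul_mol hk hs hg hf, ← integral_const_mul,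
    ← integral_neg_eq_self]
  refine integral_congr_ae (ae_of_all _ fun y => ?_)
  simp only [hpar, mul_assoc]
  congr 2
  rw [← integral_cube3_add (f := fun x => f x * g (x - -y)) (fun x m => ?_) (-y)]
  · congr 1; ext x; rw [mul_comm]; congr 2; abel
  · simp only [pf x m, add_sub_right_comm, pg _ m]

theorem mol_one_of_odd {k : V3 → ℝ} (hpar : ∀ y, k (-y) = -1 * k y) (x : V3) :
    mol k (fun _ => 1) x = 0 := by
  have := integral_neg_eq_self (μ := (volume : Measure V3)) (f := k)
  simp only [hpar, integral_const_mul] at this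
  simp only [mol, mul_one]; linarith

theorem abs_mol_sub_le {k f : V3 → ℝ} (hk : Continuous k) (hs : HasCompactSupport k)
    (h0 : ∀ y, 0 ≤ k y) (h1 : ∫ y, k y = 1) (hf : Continuous f) {x : V3} {c : ℝ}
    (hc : ∀ y, k y ≠ 0 → |f (x - y) - f x| ≤ c) : |mol k f x - f x| ≤ c := by
  have hi : Integrable k := hk.integrable_of_hasCompactSupport hs
  have e : mol k f x - f x = ∫ y, k y * (f (x - y) - f x) := by
    simp only [mul_sub]
    rw [integral_sub (integrable_mul_of_hasCompactSupport hk hs (by fun_prop))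
      (hi.mul_const (f x)), integral_mul_const, h1, one_mul, mol]
  rw [e]
  calc ‖∫ y, k y * (f (x - y) - f x)‖ ≤ ∫ y, k y * c := by
        refine norm_integral_le_of_norm_le (hi.mul_const c) (ae_of_all _ fun y => ?_)
        rw [norm_eq_abs, abs_mul, abs_of_nonneg (h0 y)]
        by_cases hy : k y = 0
        · simp [hy]
        · exact mul_le_mul_of_nonneg_left (hc y hy) (h0 y)
    _ = c := by rw [integral_mul_const, h1, one_mul]

/-- Divergence-free in the sense of distributions on the torus. -/
def WeakDivFree (u : V3 → V3) : Prop :=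
  ∀ ψ : V3 → ℝ, ContDiff ℝ (⊤ : ℕ∞) ψ → Per ψ → (∫ x in cube3, ∑ i, u x i * pd ψ i x) = 0

/-- An even smooth probability density supported in the ball of radius `ε`. -/
structure IsMollifier (ε : ℝ) (η : V3 → ℝ) : Prop where
  smooth : ContDiff ℝ (⊤ : ℕ∞) η
  compact : HasCompactSupport η
  even : ∀ y, η (-y) = η y
  nonneg : ∀ y, 0 ≤ η y
  integral_eq_one : ∫ y, η y = 1
  norm_le : ∀ y, η y ≠ 0 → ‖y‖ ≤ ε

namespace IsMollifier

variable {ε : ℝ} {η : V3 → ℝ}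

theorem continuous_pd (h : IsMollifier ε η) (i : Fin 3) : Continuous (pd η i) :=
  _root_.continuous_pd h.smooth i

theorem compact_pd (h : IsMollifier ε η) (i : Fin 3) : HasCompactSupport (pd η i) :=
  hasCompactSupport_pd h.compact i

theorem pd_neg (h : IsMollifier ε η) (i : Fin 3) (y : V3) : pd η i (-y) = -1 * pd η i y := by
  rw [pd_neg_of_even h.even, neg_one_mul]

theorem norm_le_of_pd_ne_zero (h : IsMollifier ε η) (i : Fin 3) (y : V3) (hy : pd η i y ≠ 0) :
    ‖y‖ ≤ ε := by
  have h1 : y ∈ tsupport η := by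
    refine support_fderiv_subset ℝ (f := η) ?_
    intro h0
    exact hy (by simp [pd, h0])
  have h2 : tsupport η ⊆ Metric.closedBall 0 ε :=
    closure_minimal (fun z hz => by simpa using h.norm_le z hz) Metric.isClosed_closedBall
  simpa using h2 h1

theorem integral_mul_mol_comm (h : IsMollifier ε η) {f g : V3 → ℝ} (hf : Continuous f)
    (hg : Continuous g) (pf : Per f) (pg : Per g) :
    ∫ x in cube3, f x * mol η g x = ∫ x in cube3, g x * mol η f x := by
  rw [_root_.integral_mul_mol_comm h.smooth.continuous h.compact hf hg pf pg (c := 1)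
    (by simpa using h.even), one_mul]

theorem integral_mul_mol_pd (h : IsMollifier ε η) (i : Fin 3) {f g : V3 → ℝ} (hf : Continuous f)
    (hg : Continuous g) (pf : Per f) (pg : Per g) :
    ∫ x in cube3, f x * mol (pd η i) g x = - ∫ x in cube3, g x * mol (pd η i) f x := by
  rw [_root_.integral_mul_mol_comm (h.continuous_pd i) (h.compact_pd i) hf hg pf pg (h.pd_neg i),
    neg_one_mul]

/-- The mollification of a weakly divergence-free field is divergence-free. -/
theorem sum_mol_pd_eq_zero (h : IsMollifier ε η) {u : V3 → V3} (hu : Continuous u) (hp : Per u)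
    (hd : WeakDivFree u) (x : V3) : ∑ i, mol (pd η i) (fun y => u y i) x = 0 := by
  have hui : ∀ i, Continuous fun y => u y i := fun i => by fun_prop
  have hpi : ∀ i, Per fun y => u y i := fun i x k => by simp only [hp x k]
  have hm : ∀ i, Continuous (mol (pd η i) fun y => u y i) := fun i =>
    continuous_mol_const (h.continuous_pd i) (h.compact_pd i) (hui i)
  set q : V3 → ℝ := fun x => ∑ i, mol (pd η i) (fun y => u y i) x with hq
  have qc : Continuous q := by fun_prop
  have qp : Per q := fun x k => by simp only [hq, (hpi _).mol x k]
  have qm : ∀ i, Continuous (mol (pd η i) q) := fun i =>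
    continuous_mol_const (h.continuous_pd i) (h.compact_pd i) qc
  refine Per.eq_zero_of_integral_sq (f := q) qc qp ?_ x
  have e1 : ∀ x, q x ^ 2 = ∑ i, q x * mol (pd η i) (fun y => u y i) x := fun x => by
    rw [← Finset.mul_sum, sq]
  have e2 := hd (mol η q) (contDiff_mol h.smooth h.compact qc) qp.mol
  simp only [pd_mol h.smooth h.compact qc] at e2
  rw [integral_cube3_sum fun i => by fun_prop] at e2
  simp_rw [e1]
  rw [integral_cube3_sum fun i => by fun_prop]
  simp_rw [h.integral_mul_mol_pd _ qc (hui _) qp (hpi _), Finset.sum_neg_distrib, e2, neg_zero]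

end IsMollifier

theorem abs_mol_le {k f : V3 → ℝ} (hk : Continuous k) (hs : HasCompactSupport k) {x : V3} {c : ℝ}
    (hc : ∀ y, k y ≠ 0 → |f (x - y)| ≤ c) : |mol k f x| ≤ (∫ y, |k y|) * c := by
  have hi : Integrable k := hk.integrable_of_hasCompactSupport hs
  rw [← integral_mul_const, ← norm_eq_abs, mol]
  refine norm_integral_le_of_norm_le (hi.abs.mul_const c) (ae_of_all _ fun y => ?_)
  rw [norm_eq_abs, abs_mul]
  by_cases hy : k y = 0
  · simp [hy]
  · exact mul_le_mul_of_nonneg_left (hc y hy) (abs_nonneg _)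

theorem mol_cubic {k f g : V3 → ℝ} (hk : Continuous k) (hs : HasCompactSupport k)
    (hf : Continuous f) (hg : Continuous g) (a b : ℝ) (x : V3) :
    mol k (fun z => (f z - a) ^ 2 * (g z - b)) x =
      mol k (fun z => f z ^ 2 * g z) x - b * mol k (fun z => f z ^ 2) x
        - 2 * a * mol k (fun z => f z * g z) x + 2 * a * b * mol k f x + a ^ 2 * mol k g x
        - a ^ 2 * b * mol k (fun _ => 1) x := by
  have I : ∀ {F : V3 → ℝ}, Continuous F → Integrable fun y => k y * F (x - y) := fun hF =>
    integrable_mul_of_hasCompactSupport hk hs (hF.comp (continuous_const.sub continuous_id))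
  have i1 := I ((hf.pow 2).mul hg)
  have i2 := (I (hf.pow 2)).const_mul b
  have i3 := (I (hf.mul hg)).const_mul (2 * a)
  have i4 := (I hf).const_mul (2 * a * b)
  have i5 := (I hg).const_mul (a ^ 2)
  have i6 := (I continuous_const).const_mul (a ^ 2 * b) (f := fun y => k y * 1)
  simp only [Pi.mul_apply, Pi.pow_apply] at i1 i2 i3
  simp only [mol, ← integral_const_mul]
  have s1 := integral_sub i1 i2
  have s2 := integral_sub (i1.sub i2) i3
  have s3 := integral_add ((i1.sub i2).sub i3) i4
  have s4 := integral_add (((i1.sub i2).sub i3).add i4) i5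
  have s5 := integral_sub ((((i1.sub i2).sub i3).add i4).add i5) i6
  simp only [Pi.add_apply, Pi.sub_apply] at s1 s2 s3 s4 s5
  rw [← s1, ← s2, ← s3, ← s4, ← s5]
  congr 1; ext y; ring

/-- The third-order increment identity behind the local energy flux. -/
theorem integral_mol_cubic {k f g : V3 → ℝ} (hk : Continuous k) (hs : HasCompactSupport k)
    (hpar : ∀ y, k (-y) = -1 * k y) (hf : Continuous f) (hg : Continuous g)
    (pf : Per f) (pg : Per g) :
    ∫ x in cube3, mol k (fun z => (f z - f x) ^ 2 * (g z - g x)) x =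
      2 * (∫ x in cube3, f x ^ 2 * mol k g x) + 4 * ∫ x in cube3, mol k f x * f x * g x := by
  have M : ∀ {F : V3 → ℝ}, Continuous F → Continuous (mol k F) := continuous_mol_const hk hs
  have m1 := M ((hf.pow 2).mul hg)
  have m2 := M (hf.pow 2)
  have m3 := M (hf.mul hg)
  have m4 := M hf
  have m5 := M hg
  have p2 : Per fun z => f z ^ 2 := fun x k => by simp only [pf x k]
  have p3 : Per fun z => f z * g z := fun x k => by simp only [pf x k, pg x k]
  have p1 : Per fun z => f z ^ 2 * g z := fun x k => by simp only [pf x k, pg x k]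
  have p0 : Per fun _ : V3 => (1 : ℝ) := fun x k => rfl
  have c2 : Continuous fun z => f z ^ 2 := by fun_prop
  have c3 : Continuous fun z => f z * g z := by fun_prop
  have c1 : Continuous fun z => f z ^ 2 * g z := by fun_prop
  have a1 := integral_mul_mol_comm hk hs (continuous_const (y := (1 : ℝ))) c1 p0 p1 hpar
  have a2 := integral_mul_mol_comm hk hs hg c2 pg p2 hpar
  have a3 := integral_mul_mol_comm hk hs hf c3 pf p3 hpar
  simp only [mol_one_of_odd hpar, one_mul, mul_zero, integral_zero] at a1
  simp only [mol_cubic hk hs hf hg, mol_one_of_odd hpar, mul_zero, sub_zero]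
  have e : ∀ x, mol k (fun z => f z ^ 2 * g z) x - g x * mol k (fun z => f z ^ 2) x
        - 2 * f x * mol k (fun z => f z * g z) x + 2 * f x * g x * mol k f x
        + f x ^ 2 * mol k g x
      = mol k (fun z => f z ^ 2 * g z) x - g x * mol k (fun z => f z ^ 2) x
        - 2 * (f x * mol k (fun z => f z * g z) x) + 2 * (f x * g x * mol k f x)
        + f x ^ 2 * mol k g x := fun x => by ring
  have i1 := integrableOn_cube3 m1
  have i2 := integrableOn_cube3 (hg.mul m2)
  have i3 := (integrableOn_cube3 (hf.mul m3)).const_mul 2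
  have i4 := (integrableOn_cube3 (c3.mul m4)).const_mul 2
  have i5 := integrableOn_cube3 (c2.mul m5)
  simp only [IntegrableOn] at i1 i2 i5
  simp_rw [e]
  have s1 := integral_sub i1 i2
  have s2 := integral_sub (i1.sub i2) i3
  have s3 := integral_add ((i1.sub i2).sub i3) i4
  have s4 := integral_add (((i1.sub i2).sub i3).add i4) i5
  simp only [Pi.add_apply, Pi.sub_apply, Pi.mul_apply, Pi.pow_def, Pi.mul_def, integral_const_mul]
    at s1 s2 s3 s4
  rw [s4, s3, s2, s1, a1, a2, a3]
  have e3 : ∀ x, mol k f x * f x * g x = f x * g x * mol k f x := fun x => by ring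
  simp_rw [e3]
  ring

/-- The mollified trilinear energy flux of `u`. -/
def flux (η : V3 → ℝ) (u : V3 → V3) : ℝ :=
  ∫ x in cube3, ∑ i, ∑ j, mol (pd η j) (fun y => u y i) x * u x i * u x j

theorem IsMollifier.abs_flux_le {ε : ℝ} {η : V3 → ℝ} (h : IsMollifier ε η) {u : V3 → V3}
    (hu : Continuous u) (hp : Per u) (hd : WeakDivFree u) {c M : ℝ}
    (hc : ∀ x y, ‖y‖ ≤ ε → ‖u (x - y) - u x‖ ≤ c) (hM : ∀ j, ∫ y, |pd η j y| ≤ M) :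
    |flux η u| ≤ 3 * M * c ^ 3 := by
  have hui : ∀ i, Continuous fun y => u y i := fun i => by fun_prop
  have hpi : ∀ i, Per fun y => u y i := fun i x k => by simp only [hp x k]
  have hm : ∀ i j, Continuous (mol (pd η j) fun y => u y i) := fun i j =>
    continuous_mol_const (h.continuous_pd j) (h.compact_pd j) (hui i)
  have hM0 : 0 ≤ M := (integral_nonneg fun _ => abs_nonneg _).trans (hM 0)
  have hb : ∀ i j, |∫ x in cube3, mol (pd η j)
      (fun z => (u z i - u x i) ^ 2 * (u z j - u x j)) x| ≤ M * c ^ 3 := by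
    intro i j
    have := norm_setIntegral_le_of_norm_le_const (μ := volume) (s := cube3) (C := M * c ^ 3)
      (f := fun x => mol (pd η j) (fun z => (u z i - u x i) ^ 2 * (u z j - u x j)) x)
      volume_cube3_lt_top (fun x _ => ?_)
    · simpa [volume_real_cube3] using this
    · have hcc : ∀ y, pd η j y ≠ 0 →
          |(u (x - y) i - u x i) ^ 2 * (u (x - y) j - u x j)| ≤ c ^ 3 := by
        intro y hy
        have hn := hc x y (h.norm_le_of_pd_ne_zero j y hy)
        have hi := (norm_le_pi_norm (u (x - y) - u x : V3) i).trans hn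
        have hj := (norm_le_pi_norm (u (x - y) - u x : V3) j).trans hn
        rw [Pi.sub_apply, norm_eq_abs] at hi hj
        rw [abs_mul, abs_pow, pow_succ c 2]
        gcongr
      have hc0 : 0 ≤ c ^ 3 := by
        by_contra hneg
        have hz : ∀ y, pd η j y = 0 := fun y => by
          by_contra hy
          exact hneg ((abs_nonneg _).trans (hcc y hy))
        have hε : ∃ y : V3, ‖y‖ ≤ ε := by
          by_contra! hno
          have : ∀ y, η y = 0 := fun y => by
            by_contra hy
            exact absurd (h.norm_le y hy) (not_le.2 (hno y))
          simpa [this] using h.integral_eq_one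
        obtain ⟨y, hy⟩ := hε
        exact hneg (pow_nonneg ((norm_nonneg (u (x - y) - u x)).trans (hc x y hy)) 3)
      exact (abs_mol_le (h.continuous_pd j) (h.compact_pd j) hcc).trans
        (mul_le_mul_of_nonneg_right (hM j) hc0)
  have hdiv : ∑ i, ∑ j, ∫ x in cube3, u x i ^ 2 * mol (pd η j) (fun y => u y j) x = 0 := by
    refine Finset.sum_eq_zero fun i _ => ?_
    rw [← integral_cube3_sum fun j => by fun_prop]
    simp_rw [← Finset.mul_sum, h.sum_mol_pd_eq_zero hu hp hd, mul_zero, integral_zero]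
  have hflux : flux η u = ∑ i, ∑ j, ∫ x in cube3,
      mol (pd η j) (fun y => u y i) x * u x i * u x j := by
    rw [flux, integral_cube3_sum fun i => by fun_prop]
    refine Finset.sum_congr rfl fun i _ => ?_
    rw [integral_cube3_sum fun j => by fun_prop]
  have key : 4 * flux η u = ∑ i, ∑ j, ∫ x in cube3, mol (pd η j)
      (fun z => (u z i - u x i) ^ 2 * (u z j - u x j)) x := by
    simp_rw [integral_mol_cubic (h.continuous_pd _) (h.compact_pd _) (h.pd_neg _) (hui _) (hui _)
      (hpi _) (hpi _), Finset.sum_add_distrib, ← Finset.mul_sum, hdiv, hflux]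
    ring
  have hsum : |4 * flux η u| ≤ ∑ _i : Fin 3, ∑ _j : Fin 3, M * c ^ 3 := by
    rw [key]
    exact (Finset.abs_sum_le_sum_abs _ _).trans (Finset.sum_le_sum fun i _ =>
      (Finset.abs_sum_le_sum_abs _ _).trans (Finset.sum_le_sum fun j _ => hb i j))
  have hc0 : 0 ≤ M * c ^ 3 := (abs_nonneg _).trans (hb 0 0)
  simp only [Finset.sum_const, Finset.card_univ, Fintype.card_fin, nsmul_eq_mul, abs_mul] at hsum
  norm_num at hsum
  nlinarith

/-- Rescaled mollifiers, with first derivatives of size `1 / ε` in `L¹`. -/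
theorem exists_isMollifier : ∃ M : ℝ, ∀ ε : ℝ, 0 < ε →
    ∃ η : V3 → ℝ, IsMollifier ε η ∧ ∀ j, ∫ y, |pd η j y| ≤ M / ε := by
  let ρ : ContDiffBump (0 : V3) := ⟨1 / 2, 1, by norm_num, by norm_num⟩
  set N : V3 → ℝ := ρ.normed volume with hN
  have Ns : ContDiff ℝ (⊤ : ℕ∞) N := ρ.contDiff_normed
  refine ⟨∑ j, ∫ y, |pd N j y|, fun ε hε => ?_⟩
  have hεn : ε⁻¹ ≠ 0 := inv_ne_zero hε.ne'
  have hpd : ∀ j y, pd (fun y => ε⁻¹ ^ 3 * N (ε⁻¹ • y)) j y = ε⁻¹ ^ 4 * pd N j (ε⁻¹ • y) := by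
    intro j y
    have hd : DifferentiableAt ℝ (fun y => N (ε⁻¹ • y)) y :=
      ((Ns.comp (contDiff_const_smul ε⁻¹)).differentiable (by simp)) y
    have h2 := fderiv_comp_smul (𝕜 := ℝ) (f := N) (x := y) (c := ε⁻¹)
    rw [pd, fderiv_const_mul hd, h2]
    simp only [pd, smul_apply, smul_eq_mul]
    ring
  refine ⟨fun y => ε⁻¹ ^ 3 * N (ε⁻¹ • y), ⟨?_, ?_, ?_, ?_, ?_, ?_⟩, ?_⟩
  · exact contDiff_const.mul (Ns.comp (contDiff_const_smul ε⁻¹))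
  · exact (ρ.hasCompactSupport_normed.comp_smul hεn).mul_left
  · intro y; rw [smul_neg, hN, ρ.normed_neg]
  · intro y; exact mul_nonneg (by positivity) (ρ.nonneg_normed _)
  · rw [integral_const_mul, Measure.integral_comp_inv_smul, hN, ρ.integral_normed]
    simp only [Module.finrank_fintype_fun_eq_card, Fintype.card_fin, smul_eq_mul, mul_one]
    rw [abs_of_pos (by positivity)]
    field_simp
  · intro y hy
    have h1 : ε⁻¹ • y ∈ Function.support N := fun h0 => hy (by simp [h0])
    rw [hN, ρ.support_normed_eq] at h1
    have h2 : ‖ε⁻¹ • y‖ < 1 := by simpa [ρ] using h1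
    rw [norm_smul, norm_inv, norm_eq_abs, abs_of_pos hε, inv_mul_lt_iff₀ hε] at h2
    linarith
  · intro j
    simp_rw [hpd, abs_mul]
    rw [integral_const_mul, Measure.integral_comp_inv_smul volume (fun y => |pd N j y|)]
    simp only [Module.finrank_fintype_fun_eq_card, Fintype.card_fin, smul_eq_mul]
    rw [abs_of_pos (by positivity), abs_of_pos (by positivity), ← mul_assoc]
    have e : ε⁻¹ ^ 4 * ε ^ 3 = ε⁻¹ := by field_simp
    rw [e, div_eq_inv_mul]
    refine mul_le_mul_of_nonneg_left ?_ (inv_pos.2 hε).le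
    exact Finset.single_le_sum (f := fun j => ∫ y, |pd N j y|)
      (fun _ _ => integral_nonneg fun _ => abs_nonneg _) (Finset.mem_univ j)

/-- A function whose increments are symmetric averages of a continuous kernel is an
antiderivative of twice its diagonal. -/
theorem eq_add_integral_diagonal {T : ℝ} {E : ℝ → ℝ} {Φ : ℝ → ℝ → ℝ}
    (hΦ : Continuous (Function.uncurry Φ)) (hEc : Continuous E)
    (hE : ∀ s ∈ Icc 0 T, ∀ t ∈ Icc 0 T, E t - E s = ∫ r in s..t, (Φ r s + Φ r t))
    {t : ℝ} (ht : t ∈ Icc 0 T) : E t = E 0 + 2 * ∫ r in (0 : ℝ)..t, Φ r r := by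
  have hdiag : Continuous fun r => Φ r r := hΦ.comp (f := fun r : ℝ => (r, r)) (by fun_prop)
  have hsl : ∀ s, Continuous fun r => Φ r s := fun s =>
    hΦ.comp (f := fun r : ℝ => (r, s)) (by fun_prop)
  set D : ℝ → ℝ := fun t => E t - 2 * ∫ r in (0 : ℝ)..t, Φ r r with hD
  have hDc : Continuous D := hEc.sub (continuous_const.mul
    (intervalIntegral.continuous_primitive (fun a b => hdiag.intervalIntegrable a b) 0))
  have hder : ∀ x ∈ Ico 0 T, HasDerivWithinAt D 0 (Ici x) x := by
    intro s hs
    have hloc : HasDerivWithinAt D 0 (Icc s T) s := by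
      rw [hasDerivWithinAt_iff_isLittleO, Asymptotics.isLittleO_iff]
      intro c hc
      obtain ⟨δ, hδ, hball⟩ := Metric.continuousAt_iff.1 (hΦ.continuousAt (x := (s, s))) (c / 4)
        (by positivity)
      filter_upwards [self_mem_nhdsWithin, mem_nhdsWithin_of_mem_nhds (Metric.ball_mem_nhds s hδ)]
        with t htm htb
      have hst := htm.1
      have e : D t - D s = ∫ r in s..t, (Φ r s + Φ r t - 2 * Φ r r) := by
        rw [intervalIntegral.integral_sub
            (f := fun r => Φ r s + Φ r t) (g := fun r => 2 * Φ r r)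
            (((hsl s).add (hsl t)).intervalIntegrable _ _)
            ((continuous_const.mul hdiag).intervalIntegrable _ _),
          intervalIntegral.integral_const_mul,
          ← intervalIntegral.integral_interval_sub_left (hdiag.intervalIntegrable 0 t)
            (hdiag.intervalIntegrable 0 s),
          ← hE s ⟨hs.1, hs.2.le⟩ t ⟨hs.1.trans hst, htm.2⟩, hD]
        ring
      rw [smul_zero, sub_zero, e]
      refine intervalIntegral.norm_integral_le_of_norm_le_const fun r hr => ?_
      rw [uIoc_of_le hst] at hr
      rw [Metric.mem_ball, dist_eq, abs_of_nonneg (by linarith)] at htb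
      have hn : ∀ p q, p ∈ Icc s t → q ∈ Icc s t → |Φ p q - Φ s s| < c / 4 := by
        intro p q hp hq
        refine hball (x := (p, q)) ?_
        rw [Prod.dist_eq, max_lt_iff, dist_eq, dist_eq, abs_of_nonneg (by linarith [hp.1]),
          abs_of_nonneg (by linarith [hq.1])]
        exact ⟨by linarith [hp.2], by linarith [hq.2]⟩
      have hr' : r ∈ Icc s t := ⟨hr.1.le, hr.2⟩
      have h1 := abs_lt.1 (hn r s hr' ⟨le_rfl, hst⟩)
      have h2 := abs_lt.1 (hn r t hr' ⟨hst, le_rfl⟩)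
      have h3 := abs_lt.1 (hn r r hr' hr')
      rw [norm_eq_abs, abs_le]
      constructor <;> linarith
    exact hloc.mono_of_mem_nhdsWithin (Icc_mem_nhdsGE hs.2)
  have := constant_of_has_deriv_right_zero hDc.continuousOn hder t ht
  simp only [hD, intervalIntegral.integral_same] at this
  linarith

/-- A weak (distributional in time) evolution equation holds in integrated form. -/
theorem eq_add_integral_of_weak {T a : ℝ} (hT : 0 < T) {g F : ℝ → ℝ} (hg : Continuous g)
    (hF : Continuous F)
    (h : ∀ χ : ℝ → ℝ, ContDiff ℝ (⊤ : ℕ∞) χ → (∃ T' < T, ∀ t, T' ≤ t → χ t = 0) →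
      -(a * χ 0) - (∫ s in Icc 0 T, deriv χ s * g s) = ∫ s in Icc 0 T, χ s * F s)
    {t : ℝ} (ht : t ∈ Icc 0 T) : g t = a + ∫ s in (0 : ℝ)..t, F s := by
  set H : ℝ → ℝ := fun t => a + ∫ s in (0 : ℝ)..t, F s with hH
  have hHd : ∀ t, HasDerivAt H (F t) t := fun t =>
    (intervalIntegral.integral_hasDerivAt_right (hF.intervalIntegrable 0 t)
      (hF.stronglyMeasurableAtFilter _ _) hF.continuousAt).const_add a
  have hHc : Continuous H := continuous_iff_continuousAt.2 fun t => (hHd t).continuousAt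
  have hz : ∀ᵐ x : ℝ, x ∈ Ioo 0 T → (g - H) x = 0 := by
    refine isOpen_Ioo.ae_eq_zero_of_integral_contDiff_smul_eq_zero
      ((hg.sub hHc).locallyIntegrable.locallyIntegrableOn _) fun ψ hψ hψc hψs => ?_
    set χ : ℝ → ℝ := fun t => ∫ s in T..t, ψ s with hχ
    have hχd : ∀ t, HasDerivAt χ (ψ t) t := fun t =>
      intervalIntegral.integral_hasDerivAt_right (hψ.continuous.intervalIntegrable T t)
        (hψ.continuous.stronglyMeasurableAtFilter _ _) hψ.continuous.continuousAt
    have hderiv : deriv χ = ψ := funext fun t => (hχd t).deriv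
    have hχs : ContDiff ℝ (⊤ : ℕ∞) χ :=
      contDiff_infty_iff_deriv.2 ⟨fun t => (hχd t).differentiableAt, hderiv ▸ hψ⟩
    have hvan : ∃ T' < T, ∀ t, T' ≤ t → ψ t = 0 := by
      rcases (tsupport ψ).eq_empty_or_nonempty with he | hne
      · exact ⟨T - 1, by linarith, fun t _ => image_eq_zero_of_notMem_tsupport (by simp [he])⟩
      · obtain ⟨m, hm, hmax⟩ := hψc.exists_isGreatest hne
        have := (hψs hm).2
        refine ⟨(m + T) / 2, by linarith, fun t ht =>
          image_eq_zero_of_notMem_tsupport fun hmem => ?_⟩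
        have := hmax hmem
        linarith
    obtain ⟨T', hT', hψ0⟩ := hvan
    have hχ0 : ∀ t, T' ≤ t → χ t = 0 := fun t ht => by
      rw [hχ]
      refine intervalIntegral.integral_zero_ae (ae_of_all _ fun x hx => hψ0 x ?_)
      exact (le_min hT'.le ht).trans hx.1.le
    have hw := h χ hχs ⟨T', hT', hχ0⟩
    have hparts := intervalIntegral.integral_mul_deriv_eq_deriv_mul (a := 0) (b := T)
      (fun x _ => hχd x) (fun x _ => hHd x) (hψ.continuous.intervalIntegrable _ _)
      (hF.intervalIntegrable _ _)
    rw [hderiv, integral_Icc_eq_integral_Ioc, integral_Icc_eq_integral_Ioc,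
      ← intervalIntegral.integral_of_le hT.le, ← intervalIntegral.integral_of_le hT.le, hparts,
      hχ0 T hT'.le] at hw
    have hH0 : H 0 = a := by simp [hH]
    rw [hH0] at hw
    have hsup : ∫ x, ψ x • (g - H) x = ∫ x in (0 : ℝ)..T, ψ x • (g - H) x := by
      rw [intervalIntegral.integral_of_le hT.le]
      refine (setIntegral_eq_integral_of_forall_compl_eq_zero fun x hx => ?_).symm
      rw [image_eq_zero_of_notMem_tsupport fun hmem => hx (Ioo_subset_Ioc_self (hψs hmem)),
        zero_smul]
    rw [hsup]
    simp only [Pi.sub_apply, smul_eq_mul, mul_sub]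
    rw [intervalIntegral.integral_sub (f := fun x => ψ x * g x)
      (g := fun x => ψ x * H x) ((hψ.continuous.mul hg).intervalIntegrable _ _)
      ((hψ.continuous.mul hHc).intervalIntegrable _ _)]
    linarith
  have hae : g =ᵐ[volume.restrict (Icc 0 T)] H := by
    rw [← restrict_Ioo_eq_restrict_Icc, Filter.EventuallyEq, ae_restrict_iff' measurableSet_Ioo]
    filter_upwards [hz] with x hx hmem
    exact sub_eq_zero.1 (hx hmem)
  exact Measure.eqOn_Icc_of_ae_eq volume hT.ne hae hg.continuousOn hHc.continuousOn ht

theorem contDiff_vec_apply {w : V3 → V3} (hw : ContDiff ℝ (⊤ : ℕ∞) w) (i : Fin 3) :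
    ContDiff ℝ (⊤ : ℕ∞) fun y => w y i :=
  contDiff_pi.1 hw i

theorem Per.apply {w : V3 → V3} (hw : Per w) (i : Fin 3) : Per fun y => w y i := fun x k => by
  simp only [hw x k]

/-- The right-hand side of the weak momentum equation tested against the field `w`. -/
def momentumRHS (u : V3 → V3) (th : V3 → ℝ) (w : V3 → V3) : ℝ :=
  ∫ x in cube3, ((∑ i, ∑ j, pd (fun y => w y i) j x * u x i * u x j) + th x * w x 2)

/-- The momentum equation integrated in time against a steady test field. -/
def IntegratedMomentum (T : ℝ) (vin : V3 → V3) (u : ℝ → V3 → V3) (th : ℝ → V3 → ℝ) : Prop :=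
  ∀ w : V3 → V3, ContDiff ℝ (⊤ : ℕ∞) w → Per w → (∀ x, divg w x = 0) → ∀ t ∈ Icc 0 T,
    ∫ x in cube3, ∑ i, u t x i * w x i =
      (∫ x in cube3, ∑ i, vin x i * w x i) + ∫ s in (0 : ℝ)..t, momentumRHS (u s) (th s) w

theorem IsWeakBoussinesq.integratedMomentum {T : ℝ} (hT : 0 < T) {vin : V3 → V3} {θin : V3 → ℝ}
    {v : ℝ → V3 → V3} {θ : ℝ → V3 → ℝ} (hw : IsWeakBoussinesq T vin θin v θ)
    {u : ℝ → V3 → V3} {th : ℝ → V3 → ℝ}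
    (hu : Continuous (Function.uncurry u)) (hth : Continuous (Function.uncurry th))
    (huv : ∀ t ∈ Icc 0 T, u t = v t) (hθ : ∀ t ∈ Icc 0 T, th t = θ t) :
    IntegratedMomentum T vin u th := by
  intro w hws hwp hwd t ht
  have hwi : ∀ i, Continuous fun y => w y i := fun i => (contDiff_vec_apply hws i).continuous
  have hpd : ∀ i j, Continuous (pd (fun y => w y i) j) := fun i j =>
    continuous_pd (contDiff_vec_apply hws i) j
  have hui : ∀ i, Continuous fun q : ℝ × V3 => u q.1 q.2 i := fun i =>
    (continuous_apply i).comp hu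
  have hthc : Continuous fun q : ℝ × V3 => th q.1 q.2 := hth
  refine eq_add_integral_of_weak hT (g := fun t => ∫ x in cube3, ∑ i, u t x i * w x i)
    (F := fun s => momentumRHS (u s) (th s) w) ?_ ?_ ?_ ht
  · refine continuous_integral_cube3 ?_
    simp only [Function.uncurry_def]
    exact continuous_finsetSum _ fun i _ => (hui i).mul ((hwi i).comp continuous_snd)
  · refine continuous_integral_cube3 ?_
    simp only [Function.uncurry_def]
    refine Continuous.add (continuous_finsetSum _ fun i _ => continuous_finsetSum _ fun j _ =>
      (((hpd i j).comp continuous_snd).mul (hui i)).mul (hui j)) (hthc.mul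
        ((hwi 2).comp continuous_snd))
  · intro χ hχ ⟨T', hT', hχ0⟩
    have hpdχ : ∀ s i j x,
        pd (fun y => χ s * w y i) j x = χ s * pd (fun y => w y i) j x := by
      intro s i j x
      have hd := ((contDiff_vec_apply hws i).differentiable (by simp)) x
      simp only [pd]
      rw [fderiv_const_mul hd]
      simp
    have hm := hw.momentum (fun s x => χ s • w x) ⟨?_, ?_, ⟨T', hT', ?_⟩, ?_⟩
    · have hdχ : ∀ s x i, deriv (fun r => χ r * w x i) s = deriv χ s * w x i :=
        fun s x i => deriv_mul_const ((hχ.differentiable (by simp)) s) _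
      simp only [Pi.smul_apply, smul_eq_mul, hpdχ, hdχ] at hm
      have e1 : ∫ x in cube3, ∑ i, vin x i * (χ 0 * w x i)
          = (∫ x in cube3, ∑ i, vin x i * w x i) * χ 0 := by
        rw [← integral_mul_const]
        simp_rw [Finset.sum_mul, mul_left_comm _ (χ 0), mul_comm (χ 0)]
      have e2 : ∫ s in Icc 0 T, ∫ x in cube3, ∑ i, deriv χ s * w x i * v s x i
          = ∫ s in Icc 0 T, deriv χ s * ∫ x in cube3, ∑ i, u s x i * w x i := by
        refine setIntegral_congr_fun measurableSet_Icc fun s hs => ?_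
        simp only [huv s hs, ← integral_const_mul, Finset.mul_sum]
        congr 1; ext x; congr 1; ext i; ring
      have e3 : ∫ s in Icc 0 T, ∫ x in cube3, ((∑ i, ∑ j, χ s * pd (fun y => w y i) j x *
            v s x i * v s x j) + θ s x * (χ s * w x 2))
          = ∫ s in Icc 0 T, χ s * momentumRHS (u s) (th s) w := by
        refine setIntegral_congr_fun measurableSet_Icc fun s hs => ?_
        simp only [momentumRHS, huv s hs, hθ s hs, ← integral_const_mul, Finset.mul_sum, mul_add]
        congr 1; ext x
        congr 1
        · congr 1; ext i; congr 1; ext j; ring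
        · ring
      rw [e1, e2, e3] at hm
      exact hm
    · exact (hχ.comp contDiff_fst).smul (hws.comp contDiff_snd)
    · intro s x k; simp only [hwp x k]
    · intro s x hs; simp only [hχ0 s hs, zero_smul]
    · intro s x
      have := hwd x
      simp only [divg] at this ⊢
      simp only [Pi.smul_apply, smul_eq_mul, hpdχ, ← Finset.mul_sum, this, mul_zero]

/-- Componentwise mollification of a vector field. -/
def vmol (k : V3 → ℝ) (f : V3 → V3) (x : V3) : V3 := fun i => mol k (fun y => f y i) x

namespace IsMollifier

variable {ε : ℝ} {η : V3 → ℝ}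

theorem contDiff_vmol (h : IsMollifier ε η) {f : V3 → V3} (hf : Continuous f) :
    ContDiff ℝ (⊤ : ℕ∞) (vmol η f) :=
  contDiff_pi.2 fun i => contDiff_mol h.smooth h.compact ((continuous_apply i).comp hf)

theorem pd_vmol (h : IsMollifier ε η) {f : V3 → V3} (hf : Continuous f) (i j : Fin 3) :
    pd (fun y => vmol η f y i) j = mol (pd η j) fun y => f y i :=
  pd_mol h.smooth h.compact ((continuous_apply i).comp hf) j

theorem divg_vmol (h : IsMollifier ε η) {f : V3 → V3} (hf : Continuous f) (hp : Per f)
    (hd : WeakDivFree f) (x : V3) : divg (vmol η f) x = 0 := by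
  simp only [divg, h.pd_vmol hf]
  exact h.sum_mol_pd_eq_zero hf hp hd x

theorem integral_inner_vmol_comm (h : IsMollifier ε η) {f g : V3 → V3} (hf : Continuous f)
    (hg : Continuous g) (pf : Per f) (pg : Per g) :
    ∫ x in cube3, ∑ i, f x i * vmol η g x i = ∫ x in cube3, ∑ i, g x i * vmol η f x i := by
  have hfi : ∀ i, Continuous fun y => f y i := fun i => by fun_prop
  have hgi : ∀ i, Continuous fun y => g y i := fun i => by fun_prop
  have hmf := fun i => continuous_mol_const h.smooth.continuous h.compact (hfi i)
  have hmg := fun i => continuous_mol_const h.smooth.continuous h.compact (hgi i)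
  simp only [vmol]
  rw [integral_cube3_sum fun i => by fun_prop, integral_cube3_sum fun i => by fun_prop]
  exact Finset.sum_congr rfl fun i _ =>
    h.integral_mul_mol_comm (hfi i) (hgi i) (pf.apply i) (pg.apply i)

end IsMollifier

theorem Per.vmol {k : V3 → ℝ} {f : V3 → V3} (hf : Per f) : Per (vmol k f) := fun x m => by
  ext i; exact (hf.apply i).mol x m

/-- The energy balance for the regularised kinetic energy `∫ u · (η ⋆ u)`. -/
theorem IsMollifier.energy_balance {ε : ℝ} {η : V3 → ℝ} (h : IsMollifier ε η) {T : ℝ} (hT : 0 ≤ T)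
    {vin : V3 → V3} (hvin : Continuous vin) (pvin : Per vin) (dvin : WeakDivFree vin)
    {u : ℝ → V3 → V3} {th : ℝ → V3 → ℝ} (hu : Continuous (Function.uncurry u))
    (hth : Continuous (Function.uncurry th)) (pu : ∀ t, Per (u t)) (du : ∀ t, WeakDivFree (u t))
    (hm : IntegratedMomentum T vin u th) {t : ℝ} (ht : t ∈ Icc 0 T) :
    ∫ x in cube3, ∑ i, u t x i * vmol η (u t) x i =
      (∫ x in cube3, ∑ i, vin x i * vmol η vin x i) +
        2 * ∫ r in (0 : ℝ)..t,
          (flux η (u r) + ∫ x in cube3, th r x * mol η (fun y => u r y 2) x) := by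
  have huc : ∀ t, Continuous (u t) := fun t =>
    hu.comp (f := fun x : V3 => (t, x)) (by fun_prop)
  have hui : ∀ i, Continuous fun q : ℝ × V3 => u q.1 q.2 i := fun i =>
    (continuous_apply i).comp hu
  have hthc : Continuous fun q : ℝ × V3 => th q.1 q.2 := hth
  have hmol : ∀ i, Continuous fun q : ℝ × V3 => mol η (fun y => u q.1 y i) q.2 := fun i =>
    continuous_mol h.smooth.continuous h.compact (g := fun t y => u t y i) (hui i)
  have hmolp : ∀ i j, Continuous fun q : ℝ × V3 => mol (pd η j) (fun y => u q.1 y i) q.2 :=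
    fun i j => continuous_mol (h.continuous_pd j) (h.compact_pd j) (g := fun t y => u t y i) (hui i)
  set Φ : ℝ → ℝ → ℝ := fun r s => momentumRHS (u r) (th r) (vmol η (u s)) with hΦdef
  have hΦe : ∀ r s, Φ r s = ∫ x in cube3, ((∑ i, ∑ j, mol (pd η j) (fun y => u s y i) x *
      u r x i * u r x j) + th r x * mol η (fun y => u s y 2) x) := fun r s => by
    simp only [hΦdef, momentumRHS, h.pd_vmol (huc s)]
    rfl
  have hΦ : Continuous (Function.uncurry Φ) := by
    simp only [Function.uncurry_def, hΦe]
    refine continuous_integral_cube3 (P := ℝ × ℝ) ?_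
    simp only [Function.uncurry_def]
    have hr : Continuous fun z : (ℝ × ℝ) × V3 => (z.1.1, z.2) := by fun_prop
    have hs : Continuous fun z : (ℝ × ℝ) × V3 => (z.1.2, z.2) := by fun_prop
    exact Continuous.add (continuous_finsetSum _ fun i _ => continuous_finsetSum _ fun j _ =>
      (((hmolp i j).comp hs).mul ((hui i).comp hr)).mul ((hui j).comp hr))
      ((hthc.comp hr).mul ((hmol 2).comp hs))
  have hdiag : ∀ r, Φ r r = flux η (u r) + ∫ x in cube3, th r x * mol η (fun y => u r y 2) x := by
    intro r
    have hx : Continuous fun x : V3 => (r, x) := by fun_prop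
    rw [hΦe, flux]
    refine integral_add (integrableOn_cube3 ?_) (integrableOn_cube3 ?_)
    · exact continuous_finsetSum _ fun i _ => continuous_finsetSum _ fun j _ =>
        (((hmolp i j).comp hx).mul ((hui i).comp hx)).mul ((hui j).comp hx)
    · exact (hthc.comp hx).mul ((hmol 2).comp hx)
  have hE : Continuous fun t => ∫ x in cube3, ∑ i, u t x i * vmol η (u t) x i := by
    refine continuous_integral_cube3 ?_
    exact continuous_finsetSum _ fun i _ => (hui i).mul (hmol i)
  have test : ∀ s, ∀ t ∈ Icc 0 T, ∫ x in cube3, ∑ i, u t x i * vmol η (u s) x i =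
      (∫ x in cube3, ∑ i, vin x i * vmol η (u s) x i) + ∫ r in (0 : ℝ)..t, Φ r s := fun s t ht =>
    hm _ (h.contDiff_vmol (huc s)) (pu s).vmol (h.divg_vmol (huc s) (pu s) (du s)) t ht
  have hint : ∀ s a b, IntervalIntegrable (fun r => Φ r s) volume a b := fun s a b =>
    (hΦ.comp (f := fun r : ℝ => (r, s)) (by fun_prop)).intervalIntegrable a b
  have h0 : (0 : ℝ) ∈ Icc 0 T := ⟨le_rfl, hT⟩
  have hinit : ∫ x in cube3, ∑ i, u 0 x i * vmol η (u 0) x i =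
      ∫ x in cube3, ∑ i, vin x i * vmol η vin x i := by
    have e1 := test 0 0 h0
    have e2 := hm _ (h.contDiff_vmol hvin) pvin.vmol (h.divg_vmol hvin pvin dvin) 0 h0
    rw [intervalIntegral.integral_same, add_zero] at e1 e2
    rw [e1, ← e2, h.integral_inner_vmol_comm hvin (huc 0) pvin (pu 0)]
  have := eq_add_integral_diagonal (T := T) hΦ hE (fun s hs t ht => ?_) ht
  · simp only [hinit, hdiag] at this
    exact this
  · rw [intervalIntegral.integral_add (hint s s t) (hint t s t),
      ← intervalIntegral.integral_interval_sub_left (hint s 0 t) (hint s 0 s),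
      ← intervalIntegral.integral_interval_sub_left (hint t 0 t) (hint t 0 s)]
    have e1 := test s t ht
    have e2 := test s s hs
    have e3 := test t t ht
    have e4 := test t s hs
    rw [h.integral_inner_vmol_comm (huc s) (huc t) (pu s) (pu t)] at e4
    linarith

theorem tendsto_integral_mul_mol {ε : ℕ → ℝ} (hε : Tendsto ε atTop (nhds 0)) {η : ℕ → V3 → ℝ}
    (hη : ∀ n, IsMollifier (ε n) (η n)) {f g : V3 → ℝ} (hf : Continuous f) (hg : Continuous g) :
    Tendsto (fun n => ∫ x in cube3, f x * mol (η n) g x) atTop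
      (nhds (∫ x in cube3, f x * g x)) := by
  set R : V3 → ℝ := fun y => ∫ x in cube3, f x * g (x + y) with hR
  have hRc : Continuous R := by
    refine continuous_integral_cube3 ?_
    simp only [Function.uncurry_def]; fun_prop
  have e : ∀ n, ∫ x in cube3, f x * mol (η n) g x = mol (η n) R 0 := fun n => by
    rw [integral_mul_mol (hη n).smooth.continuous (hη n).compact hf hg]
    simp only [mol, hR, sub_eq_add_neg, zero_add]
  have e0 : ∫ x in cube3, f x * g x = R 0 := by simp [hR]
  simp_rw [e, e0]
  rw [Metric.tendsto_atTop]
  intro c hc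
  obtain ⟨δ, hδ, hball⟩ := Metric.continuousAt_iff.1 (hRc.continuousAt (x := 0)) (c / 2)
    (by positivity)
  obtain ⟨n₀, hn₀⟩ := (hε.eventually_lt_const hδ).exists_forall_of_atTop
  refine ⟨n₀, fun n hn => ?_⟩
  have := abs_mol_sub_le (hη n).smooth.continuous (hη n).compact (hη n).nonneg
    (hη n).integral_eq_one hRc (x := 0) (c := c / 2) fun y hy => by
      refine (hball ?_).le
      rw [dist_zero_right, zero_sub, norm_neg]
      exact ((hη n).norm_le y hy).trans_lt (hn₀ n hn)
  rw [dist_eq]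
  linarith

theorem tendsto_integral_inner_vmol {ε : ℕ → ℝ} (hε : Tendsto ε atTop (nhds 0))
    {η : ℕ → V3 → ℝ} (hη : ∀ n, IsMollifier (ε n) (η n)) {f : V3 → V3} (hf : Continuous f) :
    Tendsto (fun n => ∫ x in cube3, ∑ i, f x i * vmol (η n) f x i) atTop
      (nhds (∫ x in cube3, ∑ i, f x i ^ 2)) := by
  have hfi : ∀ i, Continuous fun y => f y i := fun i => by fun_prop
  have hm := fun n i => continuous_mol_const (hη n).smooth.continuous (hη n).compact (hfi i)
  simp only [vmol]
  rw [integral_cube3_sum fun i => by fun_prop]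
  have e : ∀ n, ∫ x in cube3, ∑ i, f x i * mol (η n) (fun y => f y i) x =
      ∑ i, ∫ x in cube3, f x i * mol (η n) (fun y => f y i) x := fun n =>
    integral_cube3_sum fun i => (hfi i).mul (hm n i)
  simp_rw [e, sq]
  exact tendsto_finsetSum _ fun i _ => tendsto_integral_mul_mol hε hη (hfi i) (hfi i)

namespace IsMollifier

variable {ε : ℝ} {η : V3 → ℝ}

/-- The right-hand side of the regularised energy balance is close to the work of buoyancy. -/
theorem abs_flux_add_sub_le (h : IsMollifier ε η) {u : V3 → V3} {th : V3 → ℝ}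
    (hu : Continuous u) (hth : Continuous th) (hp : Per u) (hd : WeakDivFree u) {c M : ℝ}
    (hc : ∀ x y : V3, ‖y‖ ≤ ε → ‖u (x - y) - u x‖ ≤ c) (hM : ∀ j, ∫ y, |pd η j y| ≤ M) :
    |(flux η u + ∫ x in cube3, th x * mol η (fun y => u y 2) x) - ∫ x in cube3, th x * u x 2| ≤
      3 * M * c ^ 3 + c * ∫ x in cube3, |th x| := by
  have hu2 : Continuous fun y => u y 2 := by fun_prop
  have hmol := continuous_mol_const h.smooth.continuous h.compact hu2
  rw [add_sub_assoc, ← integral_sub (f := fun x => th x * mol η (fun y => u y 2) x)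
    (g := fun x => th x * u x 2) (integrableOn_cube3 (hth.mul hmol))
    (integrableOn_cube3 (hth.mul hu2))]
  refine (abs_add_le _ _).trans (add_le_add (h.abs_flux_le hu hp hd hc hM) ?_)
  rw [← integral_const_mul, ← norm_eq_abs]
  refine norm_integral_le_of_norm_le ((integrableOn_cube3 hth.abs).const_mul c)
    (ae_of_all _ fun x => ?_)
  rw [norm_eq_abs, ← mul_sub, abs_mul, mul_comm]
  refine mul_le_mul_of_nonneg_right ?_ (abs_nonneg _)
  refine abs_mol_sub_le h.smooth.continuous h.compact h.nonneg h.integral_eq_one hu2 fun y hy => ?_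
  exact (norm_le_pi_norm (u (x - y) - u x) 2).trans (hc x y (h.norm_le y hy))

theorem continuous_flux_add (h : IsMollifier ε η) {u : ℝ → V3 → V3} {th : ℝ → V3 → ℝ}
    (hu : Continuous (Function.uncurry u)) (hth : Continuous (Function.uncurry th)) :
    Continuous fun r => flux η (u r) + ∫ x in cube3, th r x * mol η (fun y => u r y 2) x := by
  have hui : ∀ i, Continuous fun q : ℝ × V3 => u q.1 q.2 i := fun i =>
    (continuous_apply i).comp hu
  have hmolp : ∀ i j, Continuous fun q : ℝ × V3 => mol (pd η j) (fun y => u q.1 y i) q.2 :=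
    fun i j => continuous_mol (h.continuous_pd j) (h.compact_pd j) (g := fun t y => u t y i) (hui i)
  refine Continuous.add (continuous_integral_cube3 ?_) (continuous_integral_cube3 ?_)
  · exact continuous_finsetSum _ fun i _ => continuous_finsetSum _ fun j _ =>
      ((hmolp i j).mul (hui i)).mul (hui j)
  · exact Continuous.mul hth
      (continuous_mol h.smooth.continuous h.compact (g := fun t y => u t y 2) (hui 2))

end IsMollifier

theorem tendsto_flux_bound {β : ℝ} (hβ : 1 / 3 < β) (C M K : ℝ) {ε : ℕ → ℝ} (hpos : ∀ n, 0 < ε n)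
    (hε : Tendsto ε atTop (nhds 0)) :
    Tendsto (fun n => 3 * (M / ε n) * (C * ε n ^ β) ^ 3 + C * ε n ^ β * K) atTop (nhds 0) := by
  have hpow : ∀ a : ℝ, 0 < a → Tendsto (fun n => ε n ^ a) atTop (nhds 0) := fun a ha => by
    have := (continuousAt_rpow_const 0 a (Or.inr ha.le)).tendsto.comp hε
    rwa [zero_rpow ha.ne'] at this
  have e : ∀ n, 3 * (M / ε n) * (C * ε n ^ β) ^ 3 = 3 * M * C ^ 3 * ε n ^ (3 * β - 1) := fun n => by
    rw [rpow_sub (hpos n), rpow_one, mul_comm 3 β, rpow_mul (hpos n).le]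
    have : (ε n ^ β) ^ (3 : ℝ) = (ε n ^ β) ^ 3 := by exact_mod_cast rpow_natCast (ε n ^ β) 3
    rw [this]
    ring
  simp_rw [e]
  simpa using ((hpow (3 * β - 1) (by linarith)).const_mul (3 * M * C ^ 3)).add
    (((hpow β (by linarith)).const_mul C).mul_const K)

/-- Energy balance for globally continuous fields that are uniformly Hölder in space with exponent
larger than one third. -/
theorem IntegratedMomentum.energy_balance {T β C : ℝ} (hT : 0 ≤ T) (hβ : 1 / 3 < β)
    {vin : V3 → V3} (hvin : Continuous vin) (pvin : Per vin) (dvin : WeakDivFree vin)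
    {u : ℝ → V3 → V3} {th : ℝ → V3 → ℝ} (hu : Continuous (Function.uncurry u))
    (hth : Continuous (Function.uncurry th)) (pu : ∀ t, Per (u t)) (du : ∀ t, WeakDivFree (u t))
    (hm : IntegratedMomentum T vin u th) (hC0 : 0 ≤ C)
    (hC : ∀ t x y, ‖u t x - u t y‖ ≤ C * ‖x - y‖ ^ β) {t : ℝ} (ht : t ∈ Icc 0 T) :
    ∫ x in cube3, ∑ i, u t x i ^ 2 =
      (∫ x in cube3, ∑ i, vin x i ^ 2) +
        2 * ∫ r in (0 : ℝ)..t, ∫ x in cube3, th r x * u r x 2 := by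
  have huc : ∀ t, Continuous (u t) := fun t =>
    hu.comp (f := fun x : V3 => (t, x)) (by fun_prop)
  have hthc : ∀ t, Continuous (th t) := fun t =>
    hth.comp (f := fun x : V3 => (t, x)) (by fun_prop)
  obtain ⟨M, hM⟩ := exists_isMollifier
  set ε : ℕ → ℝ := fun n => 1 / ((n : ℝ) + 1) with hεdef
  have hpos : ∀ n, 0 < ε n := fun n => by positivity
  have hε : Tendsto ε atTop (nhds 0) := tendsto_one_div_add_atTop_nhds_zero_nat
  choose η hη hηM using fun n => hM (ε n) (hpos n)
  have hκ : Continuous fun r => ∫ x in cube3, |th r x| :=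
    continuous_integral_cube3 hth.abs
  obtain ⟨K, hK⟩ := (isCompact_uIcc (a := (0 : ℝ)) (b := t)).exists_bound_of_continuousOn
    hκ.continuousOn
  have hW : Continuous fun r => ∫ x in cube3, th r x * u r x 2 :=
    continuous_integral_cube3 (hth.mul ((continuous_apply 2).comp hu))
  have hlim : Tendsto (fun n => ∫ r in (0 : ℝ)..t,
      (flux (η n) (u r) + ∫ x in cube3, th r x * mol (η n) (fun y => u r y 2) x)) atTop
      (nhds (∫ r in (0 : ℝ)..t, ∫ x in cube3, th r x * u r x 2)) := by
    rw [tendsto_iff_norm_sub_tendsto_zero]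
    have hb := (tendsto_flux_bound hβ C M K hpos hε).mul_const |t - 0|
    rw [zero_mul] at hb
    refine squeeze_zero (fun n => norm_nonneg _) (fun n => ?_) hb
    rw [← intervalIntegral.integral_sub
      (((hη n).continuous_flux_add hu hth).intervalIntegrable 0 t) (hW.intervalIntegrable 0 t)]
    refine intervalIntegral.norm_integral_le_of_norm_le_const fun r hr => ?_
    have hc0 : 0 ≤ C * ε n ^ β := mul_nonneg hC0 (rpow_nonneg (hpos n).le β)
    refine ((hη n).abs_flux_add_sub_le (huc r) (hthc r) (pu r) (du r) (c := C * ε n ^ β)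
      (fun x y hy => (hC r (x - y) x).trans ?_) (hηM n)).trans ?_
    · rw [sub_sub_cancel_left, norm_neg]
      gcongr
    · gcongr
      exact (le_abs_self _).trans (hK r (uIoc_subset_uIcc hr))
  refine tendsto_nhds_unique (tendsto_integral_inner_vmol hε hη (huc t)) ?_
  simp_rw [fun n => (hη n).energy_balance hT hvin pvin dvin hu hth pu du hm ht]
  exact (tendsto_integral_inner_vmol hε hη hvin).add (hlim.const_mul 2)

/-- Weak incompressibility for almost every time extends to every time by continuity. -/
theorem weakDivFree_of_ae {T : ℝ} (hT : 0 < T) {u : ℝ → V3 → V3}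
    (hu : Continuous (Function.uncurry u))
    (hd : ∀ᵐ t ∂volume.restrict (Icc 0 T), WeakDivFree (u t)) {t : ℝ} (ht : t ∈ Icc 0 T) :
    WeakDivFree (u t) := fun ψ hψ pψ => by
  have hc : Continuous fun t => ∫ x in cube3, ∑ i, u t x i * pd ψ i x := by
    refine continuous_integral_cube3 (continuous_finsetSum _ fun i _ => ?_)
    exact ((continuous_apply i).comp hu).mul ((continuous_pd hψ i).comp continuous_snd)
  refine Measure.eqOn_Icc_of_ae_eq volume hT.ne (g := fun _ => (0 : ℝ)) ?_ hc.continuousOn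
    continuousOn_const ht
  filter_upwards [hd] with s hs
  exact hs ψ hψ pψ

/-- for `β > 1/3`, every weak solution of the inviscid Boussinesq system
of class `C_t C^β_x` satisfies the kinetic energy balance. -/
theorem stmt0 (T β : ℝ) (hT : 0 < T) (hβ : 1/3 < β)
    (vin : V3 → V3) (θin : V3 → ℝ) (hdata : SmoothData vin θin)
    (v : ℝ → V3 → V3) (θ : ℝ → V3 → ℝ)
    (hw : IsWeakBoussinesq T vin θin v θ)
    (hv : ∃ C : ℝ, ∀ t ∈ Icc (0:ℝ) T, ∀ x y : V3, ‖v t x - v t y‖ ≤ C * ‖x - y‖ ^ β)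
    (hθ : ∃ C : ℝ, ∀ t ∈ Icc (0:ℝ) T, ∀ x y : V3, |θ t x - θ t y| ≤ C * ‖x - y‖ ^ β) :
    ∀ t ∈ Icc (0:ℝ) T,
      (∫ x in cube3, ∑ i, (v t x i) ^ 2)
        = (∫ x in cube3, ∑ i, (vin x i) ^ 2)
          + 2 * ∫ s in Icc (0:ℝ) t, ∫ x in cube3, θ s x * v s x 2 := by
  intro t ht
  obtain ⟨hvs, -, pvin, -, dvin⟩ := hdata
  obtain ⟨C, hC⟩ := hv
  set P : ℝ → ℝ := fun s => projIcc 0 T hT.le s with hP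
  have hPc : Continuous P := continuous_subtype_val.comp continuous_projIcc
  have hPm : ∀ s, P s ∈ Icc 0 T := fun s => (projIcc 0 T hT.le s).2
  have hPe : ∀ s ∈ Icc 0 T, P s = s := fun s hs => by simp only [hP, projIcc_of_mem hT.le hs]
  have hu : Continuous (Function.uncurry fun s => v (P s)) :=
    hw.contv.comp_continuous (f := fun q : ℝ × V3 => (P q.1, q.2)) (by fun_prop)
      fun q => ⟨hPm q.1, mem_univ _⟩
  have hth : Continuous (Function.uncurry fun s => θ (P s)) :=
    hw.contθ.comp_continuous (f := fun q : ℝ × V3 => (P q.1, q.2)) (by fun_prop)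
      fun q => ⟨hPm q.1, mem_univ _⟩
  have hm := hw.integratedMomentum hT hu hth (fun s hs => by rw [hPe s hs])
    fun s hs => by rw [hPe s hs]
  have hd : ∀ s, WeakDivFree (v (P s)) := fun s => by
    have := weakDivFree_of_ae hT hu ?_ (hPm s)
    · rwa [hPe _ (hPm s)] at this
    · filter_upwards [hw.divfree, ae_restrict_mem measurableSet_Icc] with r hr hrT
      rw [hPe r hrT]
      exact hr
  have key := hm.energy_balance hT.le hβ hvs.continuous pvin dvin hu hth (fun s => hw.perv _) hd
    (le_max_right C 0) (fun s x y => (hC _ (hPm s) x y).trans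
      (mul_le_mul_of_nonneg_right (le_max_left C 0) (by positivity))) ht
  rw [hPe t ht] at key
  rw [key, intervalIntegral.integral_of_le ht.1, integral_Icc_eq_integral_Ioc]
  congr 2
  refine setIntegral_congr_fun measurableSet_Ioc fun s hs => ?_
  simp only [hPe s ⟨hs.1.le, hs.2.trans ht.2⟩]
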